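/- Let Φ ⊂ ℝ^d_0 be a simplex set. For permutation matrices τ, σ ∈ 𝒮, one has w_τ^Φ + Δ_Φ = w_σ^Φ + Δ_Φ if and only if τ^{−1}σ ∈ ⟨θ⟩, the cyclic subgroup generated by the cycle θ. -/

import Mathlib

open scoped Pointwise

noncomputable section

abbrev SLR (d : ℕ) := Matrix.SpecialLinearGroup (Fin d) ℝ

instance (d : ℕ) : TopologicalSpace (SLR d) := instTopologicalSpaceSubtype

def Gamma (d : ℕ) : Subgroup (SLR d) :=
  (Matrix.SpecialLinearGroup.map (n := Fin d) (Int.castRingHom ℝ)).range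

abbrev XSpace (d : ℕ) := SLR d ⧸ Gamma d

def latticeOf (d : ℕ) (x : XSpace d) : Set (Fin d → ℝ) :=
  {w | ∃ g : SLR d, (QuotientGroup.mk g : XSpace d) = x ∧
      ∃ v : Fin d → ℤ, w = (g : Matrix (Fin d) (Fin d) ℝ).mulVec fun i => (v i : ℝ)}

def shortest (d : ℕ) (x : XSpace d) : ℝ :=
  sInf {r | ∃ w ∈ latticeOf d x, w ≠ 0 ∧ r = ‖w‖}

def aSL (d : ℕ) (t : Fin d → ℝ) (ht : ∑ i, t i = 0) : SLR d :=
  ⟨Matrix.diagonal fun i => Real.exp (t i), by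
    rw [Matrix.det_diagonal, ← Real.exp_sum, ht, Real.exp_zero]⟩

def Aorbit (d : ℕ) (x : XSpace d) : Set (XSpace d) :=
  {y | ∃ (t : Fin d → ℝ) (ht : ∑ i, t i = 0), y = aSL d t ht • x}

def stdLat (d : ℕ) : XSpace d := QuotientGroup.mk 1

/-- The hyperplane `ℝ^d_0` of zero coordinate sum, as a set. -/
def V0 (d : ℕ) : Set (Fin d → ℝ) := {t | ∑ i, t i = 0}

/-- The hyperplane `ℝ^d_0`, as a submodule. -/
def V0sub (d : ℕ) : Submodule ℝ (Fin d → ℝ) :=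
  LinearMap.ker (∑ i : Fin d, LinearMap.proj i)

/-- A simplex set: `d` vectors in `ℝ^d_0` summing to zero and spanning `ℝ^d_0`. -/
structure SimplexSet (d : ℕ) where
  elems : Finset (Fin d → ℝ)
  card_eq : elems.card = d
  sum_eq_zero : elems.sum id = 0
  span_eq : Submodule.span ℝ (elems : Set (Fin d → ℝ)) = V0sub d

/-- The lattice `Δ_Φ` associated to a simplex set. -/
def latticeOfSS {d : ℕ} (Φ : SimplexSet d) : AddSubgroup (Fin d → ℝ) :=
  AddSubgroup.closure (Φ.elems : Set (Fin d → ℝ))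

/-- `⌈t⌉ = max_i t_i`. -/
def ceilMax {d : ℕ} (t : Fin d → ℝ) : ℝ := ⨆ i, t i

/-- `ξ_Φ = max_{t ∈ Φ} ⌈t⌉`. -/
def xi {d : ℕ} (Φ : SimplexSet d) : ℝ :=
  sSup (ceilMax '' (Φ.elems : Set (Fin d → ℝ)))

/-- Square root of the absolute Gram determinant of a `(d-1)`-tuple of vectors. -/
def gram (d : ℕ) (v : Fin (d - 1) → (Fin d → ℝ)) : ℝ :=
  Real.sqrt |(Matrix.of fun i j : Fin (d - 1) => ∑ k, v i k * v j k).det|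

/-- The (euclidean) covolume of the lattice generated by a set `S ⊆ ℝ^d_0` of rank `d-1`:
the common value of the Gram determinant over all `(d-1)`-tuples generating the same
subgroup as `S`. -/
def covolSet (d : ℕ) (S : Set (Fin d → ℝ)) : ℝ :=
  sInf {r | ∃ v : Fin (d - 1) → (Fin d → ℝ),
      AddSubgroup.closure (Set.range v) = AddSubgroup.closure S ∧ r = gram d v}

/-- The covolume `|Δ_Φ|`. -/
def covolSS {d : ℕ} (Φ : SimplexSet d) : ℝ := covolSet d (Φ.elems : Set (Fin d → ℝ))

/-- The set `φ(stab_{UA}(x))` of logarithmic stabilizer times. -/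
def stabSet (d : ℕ) (x : XSpace d) : Set (Fin d → ℝ) :=
  {t | (∑ i, t i = 0) ∧ ∃ ε : Fin d → ℝ, (∀ i, ε i = 1 ∨ ε i = -1) ∧
      (fun v => (Matrix.diagonal fun i => ε i * Real.exp (t i)).mulVec v) '' latticeOf d x
        = latticeOf d x}

/-- The lattice `Δ_x = φ(stab_{UA}(x))`. -/
def DeltaX (d : ℕ) (x : XSpace d) : AddSubgroup (Fin d → ℝ) :=
  AddSubgroup.closure (stabSet d x)

/-- The covolume `|Δ_x|`. -/
def covolX (d : ℕ) (x : XSpace d) : ℝ := covolSet d (stabSet d x)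

/-- `Φ` is an `M`-tight simplex set for `x`. -/
def IsTight (d : ℕ) (M : ℝ) (x : XSpace d) (Φ : SimplexSet d) : Prop :=
  (Φ.elems : Set (Fin d → ℝ)) ⊆ (DeltaX d x : Set (Fin d → ℝ)) ∧
  shortest d x ≤ M * Real.exp (-((d - 1 : ℝ) / 2) * xi Φ)

/-- `Ω_M`: points of `Ω` admitting an `M`-tight simplex set. -/
def OmegaM (d : ℕ) (M : ℝ) : Set (XSpace d) :=
  {x | IsCompact (Aorbit d x) ∧ ∃ Φ : SimplexSet d, IsTight d M x Φ}

/-- The standard simplex set vectors `b_j` (with `-(d-1)` in coordinate `j`, `1` elsewhere). -/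
def bstar (d : ℕ) (j : Fin d) : Fin d → ℝ := fun i => if i = j then -(d - 1 : ℝ) else 1

/-- The points `w_τ^{Φ_*} = τ(d⁻¹ ∑_ℓ (ℓ-1) b_ℓ)`. -/
def wStar (d : ℕ) (τ : Equiv.Perm (Fin d)) : Fin d → ℝ :=
  fun i => (d : ℝ)⁻¹ * ∑ ℓ : Fin d, (ℓ : ℝ) * bstar d ℓ (τ.symm i)

/-- `h` is a distortion map for `Φ`: a linear map with `h Φ_* = |Δ_Φ|^{-1/(d-1)} Φ`. -/
def IsDistortion {d : ℕ} (Φ : SimplexSet d) (h : (Fin d → ℝ) →ₗ[ℝ] (Fin d → ℝ)) : Prop :=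
  h '' Set.range (bstar d) =
    (fun v => (covolSS Φ) ^ (-(1 : ℝ) / (d - 1 : ℝ)) • v) '' (Φ.elems : Set (Fin d → ℝ))

/-- `w_τ^Φ = |Δ_Φ|^{1/(d-1)} h_Φ (w_τ^{Φ_*})`. -/
def wPhi {d : ℕ} (Φ : SimplexSet d) (h : (Fin d → ℝ) →ₗ[ℝ] (Fin d → ℝ))
    (τ : Equiv.Perm (Fin d)) : Fin d → ℝ :=
  (covolSS Φ) ^ ((1 : ℝ) / (d - 1 : ℝ)) • h (wStar d τ)

/-- `S'` is a set of representatives for the cosets `𝒮 / ⟨θ⟩`, `θ` the cyclic rotation. -/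
def IsRepSet (d : ℕ) (S' : Set (Equiv.Perm (Fin d))) : Prop :=
  ∀ τ : Equiv.Perm (Fin d), ∃! σ, σ ∈ S' ∧ τ⁻¹ * σ ∈ Subgroup.zpowers (finRotate d)

/-- The closed ball of radius `r` in `ℝ^d_0`. -/
def ballV0 (d : ℕ) (r : ℝ) : Set (Fin d → ℝ) := {t | (∑ i, t i = 0) ∧ ‖t‖ ≤ r}

/-- Operator norm of a matrix with respect to the supremum norm. -/
def opNorm (d : ℕ) (g : Matrix (Fin d) (Fin d) ℝ) : ℝ :=
  sSup {r | ∃ v : Fin d → ℝ, ‖v‖ ≤ 1 ∧ r = ‖g.mulVec v‖}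

/-- Operator norm of a linear map restricted to the hyperplane `ℝ^d_0`. -/
def normOnV0 (d : ℕ) (h : (Fin d → ℝ) →ₗ[ℝ] (Fin d → ℝ)) : ℝ :=
  sSup {r | ∃ v : Fin d → ℝ, (∑ i, v i = 0) ∧ ‖v‖ ≤ 1 ∧ r = ‖h v‖}

/-- `Ω_M(ε, C)`. -/
def OmegaMEC (d : ℕ) (M ε C : ℝ) : Set (XSpace d) :=
  {x | IsCompact (Aorbit d x) ∧ ∃ Φ : SimplexSet d, IsTight d M x Φ ∧
    ∃ h, IsDistortion Φ h ∧
      ∀ τ : Equiv.Perm (Fin d), ∃ (hw : ∑ i, wPhi Φ h τ i = 0)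
        (g : SLR d) (s : Fin d → ℝ) (hs : ∑ i, s i = 0),
        opNorm d ((g : Matrix (Fin d) (Fin d) ℝ) - 1) ≤ C * Real.exp (-(covolX d x) ^ ε) ∧
        aSL d (wPhi Φ h τ) hw • x = (g * aSL d s hs) • stdLat d}

/-- Homothety–`GL(ℤ)` equivalence of `(d-1)`-tuples: same lattice shape. -/
def shapeRel (d : ℕ) (v w : Fin (d - 1) → (Fin d → ℝ)) : Prop :=
  ∃ c : ℝ, 0 < c ∧ ∃ g : Matrix (Fin (d - 1)) (Fin (d - 1)) ℤ, IsUnit g.det ∧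
    ∀ i, w i = c • ∑ j, ((g i j : ℝ) • v j)

/-- The space of shapes of lattices in `ℝ^d_0` (with the quotient topology). -/
def ShapeSpace (d : ℕ) := Quot (shapeRel d)

instance (d : ℕ) : TopologicalSpace (ShapeSpace d) :=
  instTopologicalSpaceQuot

/-- The shape of the lattice generated by a tuple. -/
def shapeOf (d : ℕ) (v : Fin (d - 1) → (Fin d → ℝ)) : ShapeSpace d := Quot.mk _ v

/-- An enumeration of the elements of a simplex set. -/
def ssEnum {d : ℕ} (Φ : SimplexSet d) : Fin d → (Fin d → ℝ) :=
  fun i => ((Φ.elems.equivFin.symm (finCongr Φ.card_eq.symm i)) : Fin d → ℝ)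

/-- The shape of `Δ_Φ` (generated by the first `d-1` elements of `Φ`). -/
def shapeOfSS {d : ℕ} (Φ : SimplexSet d) : ShapeSpace d :=
  shapeOf d fun i : Fin (d - 1) => ssEnum Φ (Fin.castLE (Nat.sub_le d 1) i)

/-- `Ω_{M,K}`. -/
def OmegaMK (d : ℕ) (M : ℝ) (K : Set (ShapeSpace d)) : Set (XSpace d) :=
  {x | IsCompact (Aorbit d x) ∧ ∃ Φ : SimplexSet d, IsTight d M x Φ ∧ shapeOfSS Φ ∈ K}

lemma finrank_V0sub (n : ℕ) : Module.finrank ℝ (V0sub (n + 1)) = n := by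
  have hne : (∑ i : Fin (n + 1), LinearMap.proj i : (Fin (n + 1) → ℝ) →ₗ[ℝ] ℝ) ≠ 0 := by
    intro h0
    have := LinearMap.congr_fun h0 (Pi.single 0 1)
    simp at this
  have hsurj := LinearMap.surjective hne
  have h1 := LinearMap.finrank_range_add_finrank_ker
    (∑ i : Fin (n + 1), LinearMap.proj i : (Fin (n + 1) → ℝ) →ₗ[ℝ] ℝ)
  rw [LinearMap.range_eq_top.2 hsurj, finrank_top, Module.finrank_self,
    Module.finrank_fin_fun] at h1
  unfold V0sub
  omega

/-- Vectors spanning the hyperplane and summing to zero have only the obvious linear relations. -/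
lemma coeff_eq_of_sum_smul_eq_zero {n : ℕ} {e : Fin (n + 1) → Fin (n + 1) → ℝ}
    (hspan : Submodule.span ℝ (Set.range e) = V0sub (n + 1)) (hsum : ∑ j, e j = 0)
    {r : Fin (n + 1) → ℝ} (hr : ∑ j, r j • e j = 0) (i j : Fin (n + 1)) : r i = r j := by
  have h1 := LinearMap.finrank_range_add_finrank_ker (Fintype.linearCombination ℝ e)
  rw [Fintype.range_linearCombination, hspan, finrank_V0sub, Module.finrank_fin_fun] at h1
  have hker : Module.finrank ℝ (LinearMap.ker (Fintype.linearCombination ℝ e)) = 1 := by omega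
  have hone : (fun _ => 1 : Fin (n + 1) → ℝ) ∈ LinearMap.ker (Fintype.linearCombination ℝ e) := by
    simpa [Fintype.linearCombination_apply] using hsum
  have hr' : r ∈ LinearMap.ker (Fintype.linearCombination ℝ e) := by
    simpa [Fintype.linearCombination_apply] using hr
  obtain ⟨c, hc⟩ := (finrank_eq_one_iff_of_nonzero'
    (⟨_, hone⟩ : LinearMap.ker (Fintype.linearCombination ℝ e))
    (fun h0 => one_ne_zero (congrFun (congrArg Subtype.val h0) 0))).1 hker ⟨r, hr'⟩
  have hc' : ∀ k, c = r k := fun k => by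
    simpa using congrFun (congrArg Subtype.val hc) k
  rw [← hc', ← hc']

lemma linearIndependent_castSucc {n : ℕ} {e : Fin (n + 1) → Fin (n + 1) → ℝ}
    (hspan : Submodule.span ℝ (Set.range e) = V0sub (n + 1)) (hsum : ∑ j, e j = 0) :
    LinearIndependent ℝ fun i : Fin n => e i.castSucc := by
  rw [Fintype.linearIndependent_iff]
  intro g hg i
  have hr : ∑ j, (Fin.snoc g 0 : Fin (n + 1) → ℝ) j • e j = 0 := by
    simpa [Fin.sum_univ_castSucc] using hg
  simpa using coeff_eq_of_sum_smul_eq_zero hspan hsum hr i.castSucc (Fin.last n)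

lemma mem_closure_range_iff_int {ι M : Type*} [Fintype ι] [AddCommGroup M] {e : ι → M} {x : M} :
    x ∈ AddSubgroup.closure (Set.range e) ↔ ∃ m : ι → ℤ, ∑ j, m j • e j = x := by
  rw [← Submodule.span_int_eq_addSubgroupClosure, Submodule.mem_toAddSubgroup,
    Submodule.mem_span_range_iff_exists_fun]

lemma closure_range_castSucc {n : ℕ} {M : Type*} [AddCommGroup M] {e : Fin (n + 1) → M}
    (hsum : ∑ j, e j = 0) :
    AddSubgroup.closure (Set.range fun i : Fin n => e i.castSucc) =
      AddSubgroup.closure (Set.range e) := by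
  apply le_antisymm
  · apply AddSubgroup.closure_mono
    rintro _ ⟨i, rfl⟩
    exact ⟨_, rfl⟩
  · rw [AddSubgroup.closure_le]
    rintro _ ⟨i, rfl⟩
    refine Fin.lastCases ?_ (fun i => AddSubgroup.subset_closure ⟨i, rfl⟩) i
    rw [Fin.sum_univ_castSucc] at hsum
    rw [eq_neg_of_add_eq_zero_right hsum]
    exact neg_mem (sum_mem fun i _ => AddSubgroup.subset_closure ⟨i, rfl⟩)

lemma gram_eq {n : ℕ} (v : Fin n → Fin (n + 1) → ℝ) :
    gram (n + 1) v = Real.sqrt |(Matrix.of v * (Matrix.of v).transpose).det| := rfl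

lemma gram_pos {n : ℕ} {u : Fin n → Fin (n + 1) → ℝ} (hu : LinearIndependent ℝ u) :
    0 < gram (n + 1) u := by
  rw [gram_eq]
  have hpd : (Matrix.of u * (Matrix.of u).conjTranspose).PosDef := by
    apply Matrix.PosDef.mul_conjTranspose_self
    rw [Matrix.vecMul_injective_iff]
    exact hu
  rw [Matrix.conjTranspose_eq_transpose_of_trivial] at hpd
  exact Real.sqrt_pos.2 (abs_pos.2 hpd.det_pos.ne')

lemma exists_int_matrix_of_closure_le {n : ℕ} {u v : Fin n → Fin (n + 1) → ℝ}
    (h : AddSubgroup.closure (Set.range v) ≤ AddSubgroup.closure (Set.range u)) :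
    ∃ A : Matrix (Fin n) (Fin n) ℤ, Matrix.of v = A.map (Int.castRingHom ℝ) * Matrix.of u := by
  have hv : ∀ i, ∃ m : Fin n → ℤ, ∑ j, m j • u j = v i := fun i =>
    mem_closure_range_iff_int.1 (h (AddSubgroup.subset_closure ⟨i, rfl⟩))
  choose m hm using hv
  refine ⟨Matrix.of m, ?_⟩
  ext i k
  simp [← hm, Matrix.mul_apply]

lemma gram_eq_of_closure_eq {n : ℕ} {u v : Fin n → Fin (n + 1) → ℝ}
    (hu : LinearIndependent ℝ u)
    (h : AddSubgroup.closure (Set.range v) = AddSubgroup.closure (Set.range u)) :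
    gram (n + 1) v = gram (n + 1) u := by
  obtain ⟨A, hA⟩ := exists_int_matrix_of_closure_le h.le
  obtain ⟨B, hB⟩ := exists_int_matrix_of_closure_le h.ge
  have hinj : Function.Injective fun x => Matrix.vecMul x (Matrix.of u) := by
    rw [Matrix.vecMul_injective_iff]
    exact hu
  have hBA : (B * A).map (Int.castRingHom ℝ) = 1 := by
    refine funext fun i => hinj ?_
    have : (B * A).map (Int.castRingHom ℝ) * Matrix.of u =
        (1 : Matrix (Fin n) (Fin n) ℝ) * Matrix.of u := by
      rw [Matrix.map_mul, Matrix.mul_assoc, ← hA, ← hB, Matrix.one_mul]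
    simpa only [Matrix.mul_apply_eq_vecMul] using congrFun this i
  have hdet : (A.map (Int.castRingHom ℝ)).det ^ 2 = 1 := by
    have h1 : B.det * A.det = 1 := by
      have := congrArg Matrix.det hBA
      rw [← RingHom.mapMatrix_apply, ← RingHom.map_det, Matrix.det_mul, Matrix.det_one] at this
      rw [eq_intCast] at this
      exact_mod_cast this
    rw [← RingHom.mapMatrix_apply, ← RingHom.map_det, ← map_pow,
      Int.isUnit_sq (IsUnit.of_mul_eq_one_right _ h1), map_one]
  rw [gram_eq, gram_eq, hA, Matrix.transpose_mul]
  have : (A.map (Int.castRingHom ℝ) * Matrix.of u *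
      ((Matrix.of u).transpose * (A.map (Int.castRingHom ℝ)).transpose)).det =
      (A.map (Int.castRingHom ℝ)).det ^ 2 * (Matrix.of u * (Matrix.of u).transpose).det := by
    rw [Matrix.mul_assoc, ← Matrix.mul_assoc (Matrix.of u), Matrix.det_mul, Matrix.det_mul,
      Matrix.det_transpose]
    ring
  rw [this, hdet, one_mul]

lemma range_ssEnum {d : ℕ} (Φ : SimplexSet d) : Set.range (ssEnum Φ) = Φ.elems := by
  ext x
  constructor
  · rintro ⟨i, rfl⟩
    exact Subtype.coe_prop _
  · intro hx
    exact ⟨finCongr Φ.card_eq (Φ.elems.equivFin ⟨x, hx⟩), by simp [ssEnum]⟩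

lemma sum_eq_zero_of_range_eq {d : ℕ} (Φ : SimplexSet d) {e : Fin d → Fin d → ℝ}
    (he : Set.range e = Φ.elems) : ∑ j, e j = 0 := by
  classical
  have himg : Finset.univ.image e = Φ.elems := by
    rw [← Finset.coe_inj]
    simpa using he
  have hinj : Function.Injective e := by
    rw [← Set.injOn_univ, ← Finset.coe_univ, ← Finset.card_image_iff, himg, Φ.card_eq,
      Finset.card_univ, Fintype.card_fin]
  rw [← Φ.sum_eq_zero, ← himg, Finset.sum_image hinj.injOn]
  rfl

lemma covolSS_pos {n : ℕ} (Φ : SimplexSet (n + 1)) : 0 < covolSS Φ := by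
  have hr := range_ssEnum Φ
  have hsum := sum_eq_zero_of_range_eq Φ hr
  have hu := linearIndependent_castSucc (by rw [hr, Φ.span_eq]) hsum
  have hcl := closure_range_castSucc hsum
  rw [hr] at hcl
  have : {r | ∃ v : Fin n → (Fin (n + 1) → ℝ), AddSubgroup.closure (Set.range v) =
      AddSubgroup.closure (Φ.elems : Set (Fin (n + 1) → ℝ)) ∧ r = gram (n + 1) v} =
      {gram (n + 1) fun i : Fin n => ssEnum Φ i.castSucc} := by
    ext r
    constructor
    · rintro ⟨v, hv, rfl⟩
      exact gram_eq_of_closure_eq hu (hv.trans hcl.symm)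
    · rintro rfl
      exact ⟨_, hcl, rfl⟩
  have hc : covolSS Φ = gram (n + 1) fun i : Fin n => ssEnum Φ i.castSucc := by
    change sInf {r | ∃ v : Fin n → (Fin (n + 1) → ℝ), AddSubgroup.closure (Set.range v) =
      AddSubgroup.closure (Φ.elems : Set (Fin (n + 1) → ℝ)) ∧ r = gram (n + 1) v} = _
    rw [this, csInf_singleton]
  rw [hc]
  exact gram_pos hu

lemma wStar_eq_sum {d : ℕ} (τ : Equiv.Perm (Fin d)) :
    wStar d τ = ∑ j, ((τ.symm j : ℝ) / d) • bstar d j := by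
  ext i
  rw [Finset.sum_apply, ← Equiv.sum_comp τ, wStar, Finset.mul_sum]
  refine Finset.sum_congr rfl fun l _ => ?_
  simp only [Equiv.symm_apply_apply, Pi.smul_apply, smul_eq_mul, bstar, Equiv.symm_apply_eq]
  ring

open Fin.CommRing in
lemma finRotate_pow_apply {n : ℕ} (k : ℕ) (i : Fin (n + 1)) :
    (finRotate (n + 1) ^ k) i = i + (k : Fin (n + 1)) := by
  induction k with
  | zero => simp
  | succ k ih =>
    rw [pow_succ', Equiv.Perm.mul_apply, ih, finRotate_apply, Nat.cast_succ, add_assoc]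

open Fin.CommRing in
lemma inv_mul_mem_zpowers_finRotate_iff {n : ℕ} {τ σ : Equiv.Perm (Fin (n + 1))} :
    τ⁻¹ * σ ∈ Subgroup.zpowers (finRotate (n + 1)) ↔
      ∃ k : Fin (n + 1), ∀ j, τ.symm j = σ.symm j + k := by
  rw [← mem_powers_iff_mem_zpowers, Submonoid.mem_powers_iff]
  constructor
  · rintro ⟨k, hk⟩
    refine ⟨k, fun j => ?_⟩
    rw [← finRotate_pow_apply, hk]
    simp [Equiv.Perm.inv_def]
  · rintro ⟨k, hk⟩
    refine ⟨k, Equiv.ext fun i => ?_⟩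
    rw [finRotate_pow_apply, Fin.cast_val_eq_self]
    simpa [Equiv.Perm.inv_def] using (hk (σ i)).symm

open Fin.CommRing in
/-- Two residues differ by `k` modulo `n + 1` in terms of their real representatives. -/
lemma exists_int_sub_div_iff {n : ℕ} {ι : Type*} {a b : ι → Fin (n + 1)} :
    (∃ (s : ℝ) (m : ι → ℤ), ∀ j, ((a j : ℝ) - (b j : ℝ)) / ((n + 1 : ℕ) : ℝ) = m j + s) ↔
      ∃ k : Fin (n + 1), ∀ j, a j = b j + k := by
  have hpos : ((n + 1 : ℕ) : ℝ) ≠ 0 := by positivity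
  constructor
  · rintro ⟨s, m, h⟩
    rcases isEmpty_or_nonempty ι with hι | ⟨⟨j₀⟩⟩
    · exact ⟨0, fun j => isEmptyElim j⟩
    refine ⟨a j₀ - b j₀, fun j => ?_⟩
    have key : ((a j : ℤ) - b j) - ((a j₀ : ℤ) - b j₀) = (n + 1 : ℕ) * (m j - m j₀) := by
      have h1 := h j
      have h2 := h j₀
      rw [div_eq_iff hpos] at h1 h2
      have : (((a j : ℕ) : ℝ) - (b j : ℕ)) - (((a j₀ : ℕ) : ℝ) - (b j₀ : ℕ))
          = ((n + 1 : ℕ) : ℝ) * (m j - m j₀) := by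
        rw [h1, h2]; ring
      exact_mod_cast this
    have hcast := congrArg (Int.cast : ℤ → Fin (n + 1)) key
    push_cast at hcast
    have hz : ((n : Fin (n + 1)) + 1) = 0 := by simp
    rw [hz, zero_mul, sub_eq_zero] at hcast
    rw [← hcast]
    abel
  · rintro ⟨k, hk⟩
    refine ⟨k / (n + 1 : ℕ), fun j => -(((b j + k : ℕ) / (n + 1) : ℕ) : ℤ), fun j => ?_⟩
    have hmod := Nat.mod_add_div (b j + k : ℕ) (n + 1)
    rw [← Fin.val_add, ← hk] at hmod
    have hmod' := congrArg (Nat.cast : ℕ → ℝ) hmod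
    rw [Nat.cast_add, Nat.cast_mul, Nat.cast_add (b j : ℕ)] at hmod'
    rw [div_eq_iff hpos, add_mul, div_mul_cancel₀ _ hpos, Int.cast_neg, Int.cast_natCast]
    linarith

theorem stmt13 (d : ℕ) (hd : 2 ≤ d) (Φ : SimplexSet d)
    (h : (Fin d → ℝ) →ₗ[ℝ] (Fin d → ℝ)) (hh : IsDistortion Φ h)
    (τ σ : Equiv.Perm (Fin d)) :
    wPhi Φ h τ +ᵥ (latticeOfSS Φ : Set (Fin d → ℝ)) =
        wPhi Φ h σ +ᵥ (latticeOfSS Φ : Set (Fin d → ℝ)) ↔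
      τ⁻¹ * σ ∈ Subgroup.zpowers (finRotate d) := by
  obtain ⟨n, rfl⟩ : ∃ n, d = n + 1 := ⟨d - 1, by omega⟩
  set c : ℝ := (covolSS Φ) ^ ((1 : ℝ) / (((n + 1 : ℕ) : ℝ) - 1)) with hc
  have hc0 : c ≠ 0 := (Real.rpow_pos_of_pos (covolSS_pos Φ) _).ne'
  have hcinv : (covolSS Φ) ^ (-(1 : ℝ) / (((n + 1 : ℕ) : ℝ) - 1)) = c⁻¹ := by
    rw [neg_div, Real.rpow_neg (covolSS_pos Φ).le]
  set e : Fin (n + 1) → Fin (n + 1) → ℝ := fun j => c • h (bstar (n + 1) j) with he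
  have hrange : Set.range e = Φ.elems := by
    have h1 : Set.range e = (fun v => c • v) '' (h '' Set.range (bstar (n + 1))) := by
      rw [← Set.range_comp, ← Set.range_comp]
      rfl
    rw [h1, hh, hcinv, Set.image_image]
    simp [smul_smul, hc0]
  have hsum := sum_eq_zero_of_range_eq Φ hrange
  have hspan : Submodule.span ℝ (Set.range e) = V0sub (n + 1) := by rw [hrange, Φ.span_eq]
  have hw : ∀ ρ : Equiv.Perm (Fin (n + 1)),
      wPhi Φ h ρ = ∑ j, ((ρ.symm j : ℝ) / ((n + 1 : ℕ) : ℝ)) • e j := by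
    intro ρ
    rw [wPhi, ← hc, wStar_eq_sum, map_sum, Finset.smul_sum]
    refine Finset.sum_congr rfl fun j _ => ?_
    rw [map_smul, smul_comm]
  rw [eq_comm, leftAddCoset_eq_iff, latticeOfSS, ← hrange, mem_closure_range_iff_int,
    inv_mul_mem_zpowers_finRotate_iff, ← exists_int_sub_div_iff]
  have hdiff : -wPhi Φ h σ + wPhi Φ h τ =
      ∑ j, (((τ.symm j : ℝ) - (σ.symm j : ℝ)) / ((n + 1 : ℕ) : ℝ)) • e j := by
    rw [hw, hw, neg_add_eq_sub, ← Finset.sum_sub_distrib]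
    refine Finset.sum_congr rfl fun j _ => ?_
    rw [← sub_smul, sub_div]
  rw [hdiff]
  constructor
  · rintro ⟨m, hm⟩
    have hr : ∑ j, (((τ.symm j : ℝ) - (σ.symm j : ℝ)) / ((n + 1 : ℕ) : ℝ) - m j) • e j = 0 := by
      simp only [sub_smul _ (Int.cast _ : ℝ), Int.cast_smul_eq_zsmul]
      rw [Finset.sum_sub_distrib, hm, sub_self]
    refine ⟨((τ.symm 0 : ℝ) - (σ.symm 0 : ℝ)) / ((n + 1 : ℕ) : ℝ) - m 0, m, fun j => ?_⟩
    have := coeff_eq_of_sum_smul_eq_zero hspan hsum hr j 0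
    linarith
  · rintro ⟨s, m, hm⟩
    refine ⟨m, ?_⟩
    simp only [hm, add_smul, Finset.sum_add_distrib, ← Finset.smul_sum, hsum, smul_zero, add_zero,
      Int.cast_smul_eq_zsmul]
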